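/- Let n be a natural number with 2 ≤ n, and let σ be a permutation of ZMod n such that for every i : ZMod n, either σ i = i or σ i = i + 1. Then either σ is the identity permutation, or σ is the cyclic shift sending every i to i + 1 (i.e. σ = Equiv.addRight 1). -/

import Mathlib

theorem stmt_0 (n : ℕ) (hn : 2 ≤ n) (σ : Equiv.Perm (ZMod n))
    (h : ∀ i : ZMod n, σ i = i ∨ σ i = i + 1) :
    σ = Equiv.refl (ZMod n) ∨ σ = Equiv.addRight (1 : ZMod n) := by
  have : Fact (1 < n) := ⟨hn⟩
  have : NeZero n := ⟨by omega⟩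
  by_cases hfix : ∀ i, σ i = i
  · exact Or.inl (Equiv.ext hfix)
  right
  push Not at hfix
  obtain ⟨i, hi⟩ := hfix
  have step (j : ZMod n) (hj : σ j = j + 1) : σ (j + 1) = j + 1 + 1 :=
    (h (j + 1)).resolve_left fun hfixed =>
      one_ne_zero (add_eq_left.mp (σ.injective (hfixed.trans hj.symm)))
  have shift (k : ℕ) : σ (i + k) = i + k + 1 := by
    induction k with
    | zero => simpa using (h i).resolve_left hi
    | succ k ih => simpa [add_assoc] using step _ ih
  ext1 j
  simpa using shift (j - i).val
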